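/- There exist universal constants c₀, c₁, c₂ > 0 such that for all β > 0, all K ≥ (3/2)β, and all σ with |σ − 1| ≤ 1/2: β · | L_K′(βσ) | ≤ K · e^{9β²/8} ( c₀/β + c₁ + c₂ β ). -/

import Mathlib

open MeasureTheory ProbabilityTheory

/-- `Φ`, the cumulative distribution function of the standard normal distribution. -/
noncomputable def Phi (x : ℝ) : ℝ := ((gaussianReal 0 1) (Set.Iic x)).toReal

/-- `L_K(s) = e^{s²/2} (Φ((K−s²)/s) − Φ((−K−s²)/s)) / (Φ(K/s) − Φ(−K/s))`. -/
noncomputable def LK (K s : ℝ) : ℝ :=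
  Real.exp (s ^ 2 / 2) * (Phi ((K - s ^ 2) / s) - Phi ((-K - s ^ 2) / s)) /
    (Phi (K / s) - Phi (-K / s))

lemma hasDerivAt_Phi (x : ℝ) : HasDerivAt Phi (gaussianPDFReal 0 1 x) x := by
  have hcont : Continuous (gaussianPDFReal 0 1) := by
    unfold gaussianPDFReal
    fun_prop
  have hint : Integrable (gaussianPDFReal 0 1) := integrable_gaussianPDFReal 0 1
  have hPhi : ∀ y, Phi y = ∫ t in Set.Iic y, gaussianPDFReal 0 1 t := fun y ↦ by
    rw [Phi, gaussianReal_apply_eq_integral 0 one_ne_zero, ENNReal.toReal_ofReal]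
    exact integral_nonneg fun t ↦ gaussianPDFReal_nonneg 0 1 t
  have heq : Phi = fun y ↦ Phi 0 + ∫ t in (0 : ℝ)..y, gaussianPDFReal 0 1 t := by
    funext y
    rw [hPhi y, hPhi 0, ← intervalIntegral.integral_Iic_sub_Iic hint.integrableOn
      hint.integrableOn]
    ring
  rw [heq]
  exact (intervalIntegral.integral_hasDerivAt_right (hcont.intervalIntegrable _ _)
    (hcont.stronglyMeasurableAtFilter _ _) hcont.continuousAt).const_add _

lemma strictMono_Phi : StrictMono Phi :=
  strictMono_of_deriv_pos fun x ↦ by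
    rw [(hasDerivAt_Phi x).deriv]
    exact gaussianPDFReal_pos 0 1 x one_ne_zero

lemma Phi_nonneg (x : ℝ) : 0 ≤ Phi x := ENNReal.toReal_nonneg

lemma Phi_le_one (x : ℝ) : Phi x ≤ 1 :=
  ENNReal.toReal_le_of_le_ofReal zero_le_one (by simpa using prob_le_one)

lemma gaussianPDFReal_zero_one_le_one (x : ℝ) : gaussianPDFReal 0 1 x ≤ 1 := by
  rw [gaussianPDFReal]
  have h₁ : (√(2 * Real.pi * (1 : NNReal)))⁻¹ ≤ 1 := by
    apply inv_le_one_of_one_le₀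
    rw [Real.one_le_sqrt]
    have := Real.pi_gt_three
    push_cast
    linarith
  have h₂ : Real.exp (-(x - 0) ^ 2 / (2 * (1 : NNReal))) ≤ 1 := by
    rw [Real.exp_le_one_iff, neg_div]
    exact neg_nonpos.2 (by positivity)
  exact mul_le_one₀ h₁ (Real.exp_pos _).le h₂

/-- The quotient rule for `LK K`, as a bound valid for `0 < s ≤ K`. -/
lemma abs_deriv_LK_le {K s : ℝ} (hs : 0 < s) (hK : s ≤ K) :
    |deriv (LK K) s| ≤ Real.exp (s ^ 2 / 2) *
      (s / (Phi 1 - Phi (-1)) + 2 * (K / s ^ 2 + 1) / (Phi 1 - Phi (-1)) +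
        2 * (K / s ^ 2) / (Phi 1 - Phi (-1)) ^ 2) := by
  have hs0 : s ≠ 0 := hs.ne'
  have hd : 0 < Phi 1 - Phi (-1) := sub_pos.2 (strictMono_Phi (by norm_num))
  set d := Phi 1 - Phi (-1) with hd_def
  have hKs : 1 ≤ K / s := (one_le_div hs).2 hK
  have hD : d ≤ Phi (K / s) - Phi (-K / s) :=
    sub_le_sub (strictMono_Phi.monotone hKs)
      (strictMono_Phi.monotone (by rw [neg_div]; linarith))
  have hpdf : ∀ x, |gaussianPDFReal 0 1 x| ≤ 1 := fun x ↦ by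
    rw [abs_of_nonneg (gaussianPDFReal_nonneg 0 1 x)]
    exact gaussianPDFReal_zero_one_le_one x
  have hq : 0 ≤ K / s ^ 2 := div_nonneg (hs.le.trans hK) (sq_nonneg s)
  have hquot : ∀ a : ℝ, HasDerivAt (fun t ↦ a / t) (-(a / s ^ 2)) s := fun a ↦ by
    simpa only [div_eq_mul_inv, mul_neg] using (hasDerivAt_inv hs0).const_mul a
  have hshift : ∀ a : ℝ, HasDerivAt (fun t ↦ (a - t ^ 2) / t) (-(a / s ^ 2) - 1) s := fun a ↦ by
    refine ((hquot a).sub (hasDerivAt_id s)).congr_of_eventuallyEq ?_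
    filter_upwards [eventually_ne_nhds hs0] with t ht
    simp only [Pi.sub_apply, id]
    field_simp
  have hE : HasDerivAt (fun t : ℝ ↦ Real.exp (t ^ 2 / 2)) (Real.exp (s ^ 2 / 2) * s) s := by
    convert (((hasDerivAt_pow 2 s).div_const 2).exp) using 1
    simp
  have hN := ((hasDerivAt_Phi _).comp s (hshift K)).sub ((hasDerivAt_Phi _).comp s (hshift (-K)))
  have hDen := ((hasDerivAt_Phi _).comp s (hquot K)).sub ((hasDerivAt_Phi _).comp s (hquot (-K)))
  have hDne : Phi (K / s) - Phi (-K / s) ≠ 0 := (hd.trans_le hD).ne'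
  have hL := ((hE.mul hN).div hDen hDne).deriv
  change deriv (LK K) s = _ at hL
  rw [hL]
  simp only [Pi.sub_apply, Pi.mul_apply, Function.comp_apply]
  have hNabs : |Phi ((K - s ^ 2) / s) - Phi ((-K - s ^ 2) / s)| ≤ 1 := by
    rw [abs_le]
    constructor <;> linarith [Phi_nonneg ((K - s ^ 2) / s), Phi_nonneg ((-K - s ^ 2) / s),
      Phi_le_one ((K - s ^ 2) / s), Phi_le_one ((-K - s ^ 2) / s)]
  have hN' : |gaussianPDFReal 0 1 ((K - s ^ 2) / s) * (-(K / s ^ 2) - 1) -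
      gaussianPDFReal 0 1 ((-K - s ^ 2) / s) * (-(-K / s ^ 2) - 1)| ≤ 2 * (K / s ^ 2 + 1) := by
    have h₁ : |-(K / s ^ 2) - 1| ≤ K / s ^ 2 + 1 := by
      rw [abs_le]; constructor <;> linarith
    have h₂ : |-(-K / s ^ 2) - 1| ≤ K / s ^ 2 + 1 := by
      rw [neg_div, abs_le]; constructor <;> linarith
    refine (abs_sub _ _).trans ?_
    rw [abs_mul, abs_mul, two_mul]
    exact add_le_add
      ((mul_le_mul (hpdf _) h₁ (abs_nonneg _) zero_le_one).trans_eq (one_mul _))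
      ((mul_le_mul (hpdf _) h₂ (abs_nonneg _) zero_le_one).trans_eq (one_mul _))
  have hD' : |gaussianPDFReal 0 1 (K / s) * -(K / s ^ 2) -
      gaussianPDFReal 0 1 (-K / s) * -(-K / s ^ 2)| ≤ 2 * (K / s ^ 2) := by
    have h₁ : |-(K / s ^ 2)| ≤ K / s ^ 2 := by rw [abs_neg, abs_of_nonneg hq]
    have h₂ : |-(-K / s ^ 2)| ≤ K / s ^ 2 := by rw [neg_div, neg_neg, abs_of_nonneg hq]
    refine (abs_sub _ _).trans ?_
    rw [abs_mul, abs_mul, two_mul]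
    exact add_le_add
      ((mul_le_mul (hpdf _) h₁ (abs_nonneg _) zero_le_one).trans_eq (one_mul _))
      ((mul_le_mul (hpdf _) h₂ (abs_nonneg _) zero_le_one).trans_eq (one_mul _))
  generalize gaussianPDFReal 0 1 ((K - s ^ 2) / s) * (-(K / s ^ 2) - 1) -
      gaussianPDFReal 0 1 ((-K - s ^ 2) / s) * (-(-K / s ^ 2) - 1) = N' at *
  generalize gaussianPDFReal 0 1 (K / s) * -(K / s ^ 2) -
      gaussianPDFReal 0 1 (-K / s) * -(-K / s ^ 2) = D' at *
  generalize Phi ((K - s ^ 2) / s) - Phi ((-K - s ^ 2) / s) = N at *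
  generalize Phi (K / s) - Phi (-K / s) = D at *
  have hDpos : 0 < D := hd.trans_le hD
  have hsplit : ((Real.exp (s ^ 2 / 2) * s * N + Real.exp (s ^ 2 / 2) * N') * D -
      Real.exp (s ^ 2 / 2) * N * D') / D ^ 2 =
      Real.exp (s ^ 2 / 2) * (s * N / D + N' / D - N * D' / D ^ 2) := by
    field_simp
  rw [hsplit, abs_mul, abs_of_pos (Real.exp_pos _)]
  refine mul_le_mul_of_nonneg_left ?_ (Real.exp_pos _).le
  refine (abs_sub _ _).trans (add_le_add ((abs_add_le _ _).trans (add_le_add ?_ ?_)) ?_)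
  · rw [abs_div, abs_of_pos hDpos, abs_mul, abs_of_pos hs]
    exact div_le_div₀ hs.le (mul_le_of_le_one_right hs.le hNabs) hd hD
  · rw [abs_div, abs_of_pos hDpos]
    exact div_le_div₀ (by positivity) hN' hd hD
  · rw [abs_div, abs_of_pos (pow_pos hDpos 2), abs_mul]
    refine div_le_div₀ (by positivity) ?_ (pow_pos hd 2) (pow_le_pow_left₀ hd.le hD 2)
    exact (mul_le_mul hNabs hD' (abs_nonneg _) zero_le_one).trans_eq (one_mul _)

/-- There exist universal constants `c₀, c₁, c₂ > 0` such that for all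
`β > 0`, all `K ≥ (3/2)β`, and all `σ` with `|σ − 1| ≤ 1/2`:
`β |L_K′(βσ)| ≤ K e^{9β²/8} (c₀/β + c₁ + c₂ β)`. -/
theorem stmt10 : ∃ c₀ c₁ c₂ : ℝ, 0 < c₀ ∧ 0 < c₁ ∧ 0 < c₂ ∧
    ∀ β K σ : ℝ, 0 < β → 3 / 2 * β ≤ K → |σ - 1| ≤ 1 / 2 →
      β * |deriv (fun t => LK K t) (β * σ)| ≤
        K * Real.exp (9 * β ^ 2 / 8) * (c₀ / β + c₁ + c₂ * β) := by
  have hd : 0 < Phi 1 - Phi (-1) := sub_pos.2 (strictMono_Phi (by norm_num))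
  have hbound := @abs_deriv_LK_le
  generalize Phi 1 - Phi (-1) = d at hd hbound
  refine ⟨8 / d + 8 / d ^ 2, 2 / d, 1 / d, by positivity, by positivity, by positivity, ?_⟩
  intro β K σ hβ hK hσ
  obtain ⟨hσ₁, hσ₂⟩ := abs_le.1 hσ
  have hs₁ : β / 2 ≤ β * σ := by nlinarith
  have hs₂ : β * σ ≤ 3 / 2 * β := by nlinarith
  change β * |deriv (LK K) (β * σ)| ≤ _
  generalize β * σ = s at hs₁ hs₂ ⊢
  have hs : 0 < s := by linarith
  have hKpos : 0 < K := by linarith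
  have hexp : Real.exp (s ^ 2 / 2) ≤ Real.exp (9 * β ^ 2 / 8) :=
    Real.exp_le_exp.2 (by nlinarith)
  have hq : K / s ^ 2 ≤ 4 * K / β ^ 2 := by
    rw [div_le_div_iff₀ (by positivity) (by positivity)]
    nlinarith [mul_le_mul_of_nonneg_left (pow_le_pow_left₀ (by positivity) hs₁ 2) hKpos.le]
  calc β * |deriv (LK K) s|
      ≤ β * (Real.exp (9 * β ^ 2 / 8) *
          (K / d + 2 * (4 * K / β ^ 2 + K / β) / d + 2 * (4 * K / β ^ 2) / d ^ 2)) := by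
        refine mul_le_mul_of_nonneg_left ((hbound hs (hs₂.trans hK)).trans ?_) hβ.le
        have hsK : s ≤ K := hs₂.trans hK
        have hKβ : 1 ≤ K / β := (one_le_div hβ).2 (by linarith)
        gcongr
    _ = K * Real.exp (9 * β ^ 2 / 8) * ((8 / d + 8 / d ^ 2) / β + 2 / d + 1 / d * β) := by
        field_simp
        ring
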